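/- Let (P_t)_{t∈I} be a Markov semigroup on X, where I = [0,∞) or I = {nδ : n ∈ ℕ} for some δ > 0, and let Λ be a fixed collection of distance-like functions ρ : X × X → [0,1]. Assume: (A1) there exist a continuous ψ : [0,∞) → [0,∞) with ψ(t) → 0 as t → ∞ and constants α₀ > 0, C₀ > 0 such that ∫_X exp(α‖u‖²) P_t(u₀,du) ≤ exp(α(ψ(t)‖u₀‖² + C₀)) for all α ∈ (0,α₀], t ∈ I, u₀ ∈ X; (A2) for every M > 0 there exists κ₁ = κ₁(M) ∈ (0,1) such that for every ρ ∈ Λ there exists T₁ = T₁(M,ρ) > 0 with W_ρ(P_t(u₀,·), P_t(v₀,·)) ≤ 1 − κ₁ for all t ∈ I with t ≥ T₁ and all u₀, v₀ with ‖u₀‖ ≤ M, ‖v₀‖ ≤ M; (A3) for every κ₂ ∈ (0,1) and r > 0 there exists ρ ∈ Λ such that both: (A3.i) there is T₂ > 0 with W_ρ(P_t(u₀,·), P_t(v₀,·)) ≤ κ₂ · exp(r‖u₀‖²) · ρ(u₀,v₀) for all t ∈ I with t ≥ T₂ and all u₀, v₀ with ρ(u₀,v₀) < 1, and (A3.ii)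 for every τ ≥ 0 there is C > 0 with W_ρ(P_t(u₀,·), P_t(v₀,·)) ≤ C · exp(r‖u₀‖²) · ρ(u₀,v₀) for all t ∈ I ∩ [0,τ] and all u₀, v₀ with ρ(u₀,v₀) < 1. Then for every real m ≥ 1 there exists α_m > 0 such that for each α ∈ (0,α_m] there exist ρ ∈ Λ, T > 0 and constants C₁, C₂ > 0 such that W_{ρ_α}(μP_t, νP_t) ≤ C₁ e^{−C₂ t} · W_{ρ_{α/m}}(μ,ν) for every t ∈ I with t ≥ T and all Borel probability measures μ, ν on X. -/

import Mathlib

open MeasureTheory ENNReal Filter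

noncomputable section

/-- A coupling of two Borel probability measures: a measure on the product whose
marginals are the given measures. -/
def IsCoupling {X : Type*} [MeasurableSpace X] (μ ν : Measure X)
    (Γ : Measure (X × X)) : Prop :=
  Γ.map Prod.fst = μ ∧ Γ.map Prod.snd = ν

/-- The Wasserstein-like extension of a distance-like function `ρ` to probability
measures: the infimum over couplings of the integral of `ρ`. -/
noncomputable def wassLike {X : Type*} [MeasurableSpace X] (ρ : X → X → ℝ)
    (μ ν : Measure X) : ℝ≥0∞ :=
  ⨅ (Γ : Measure (X × X)) (_ : IsProbabilityMeasure Γ) (_ : IsCoupling μ ν Γ),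
    ∫⁻ p, ENNReal.ofReal (ρ p.1 p.2) ∂Γ

/-- A distance-like function: nonnegative, symmetric, lower semicontinuous, and
vanishing exactly on the diagonal. -/
def DistanceLike {X : Type*} [TopologicalSpace X] (ρ : X → X → ℝ) : Prop :=
  (∀ u v, 0 ≤ ρ u v) ∧ (∀ u v, ρ u v = ρ v u) ∧
    LowerSemicontinuous (fun p : X × X => ρ p.1 p.2) ∧
    (∀ u v, ρ u v = 0 ↔ u = v)

/-- A Markov kernel given as a measurable family of probability measures. -/
def IsMarkovKernelFun {X : Type*} [MeasurableSpace X] (P : X → Measure X) : Prop :=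
  Measurable P ∧ ∀ u, IsProbabilityMeasure (P u)

/-- The weighted distance-like function `ρ_a(u,v) = ρ(u,v)^{1/2} exp(a‖u‖² + a‖v‖²)`. -/
noncomputable def expWeight {X : Type*} [NormedAddCommGroup X]
    (ρ : X → X → ℝ) (a : ℝ) (u v : X) : ℝ :=
  Real.sqrt (ρ u v) * Real.exp (a * ‖u‖ ^ 2 + a * ‖v‖ ^ 2)

open Topology

/-- A measurable map into a separable pseudometric space is uniformly approximated by its
values at countably many sample points, selected measurably. -/
lemma exists_measurable_sampling {S Y : Type*} [MeasurableSpace S] [Nonempty S]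
    [PseudoMetricSpace Y] [SecondCountableTopology Y] [MeasurableSpace Y] [OpensMeasurableSpace Y]
    {f : S → Y} (hf : Measurable f) {ε : ℝ} (hε : 0 < ε) :
    ∃ (φ : S → ℕ) (r : ℕ → S), Measurable φ ∧ ∀ s, dist (f (r (φ s))) (f s) < ε := by
  classical
  have : Nonempty Y := ⟨f (Classical.arbitrary S)⟩
  have hd := TopologicalSpace.denseRange_denseSeq Y
  set d := TopologicalSpace.denseSeq Y
  have hex : ∀ s, ∃ k, dist (f s) (d k) < ε / 2 := fun s ↦ hd.exists_dist_lt _ (half_pos hε)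
  refine ⟨fun s ↦ Nat.find (hex s),
    fun k ↦ if h : ∃ s, Nat.find (hex s) = k then h.choose else Classical.arbitrary S,
    measurable_find hex fun k ↦ ?_, fun s ↦ ?_⟩
  · exact hf (Metric.isOpen_ball (x := d k) (ε := ε / 2)).measurableSet
  · have h : ∃ s', Nat.find (hex s') = Nat.find (hex s) := ⟨s, rfl⟩
    simp only [dif_pos h]
    have h1 := Nat.find_spec (hex h.choose)
    rw [h.choose_spec] at h1
    have h2 := Nat.find_spec (hex s)
    calc dist (f h.choose) (f s)
        ≤ dist (f h.choose) (d (Nat.find (hex s))) + dist (f s) (d (Nat.find (hex s))) :=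
          dist_triangle_right _ _ _
      _ < ε := by linarith

/-- Sequential version of `exists_measurable_sampling`, controlling in addition a real-valued
function uniformly from above. -/
lemma exists_seq_measurable_sampling {S Y : Type*} [MeasurableSpace S] [Nonempty S]
    [TopologicalSpace Y] [TopologicalSpace.PseudoMetrizableSpace Y] [SecondCountableTopology Y]
    [MeasurableSpace Y] [BorelSpace Y] {f : S → Y} (hf : Measurable f)
    {g : S → ℝ} (hg : Measurable g) :
    ∃ (φ : ℕ → S → ℕ) (r : ℕ → ℕ → S), (∀ n, Measurable (φ n)) ∧
      (∀ s, Tendsto (fun n ↦ f (r n (φ n s))) atTop (𝓝 (f s))) ∧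
      ∀ (n : ℕ) s, g (r n (φ n s)) ≤ g s + 1 / (n + 1) := by
  let := TopologicalSpace.pseudoMetrizableSpacePseudoMetric Y
  have hpos : ∀ n : ℕ, (0 : ℝ) < 1 / (n + 1) := fun n ↦ by positivity
  choose φ r hφ hr using fun n : ℕ ↦ exists_measurable_sampling (hf.prodMk hg) (hpos n)
  refine ⟨φ, r, hφ, fun s ↦ ?_, fun n s ↦ ?_⟩
  · rw [tendsto_iff_dist_tendsto_zero]
    refine squeeze_zero (fun _ ↦ dist_nonneg) (fun n ↦ ?_) tendsto_one_div_add_atTop_nhds_zero_nat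
    exact (le_max_left _ _).trans (hr n s).le
  · have h : dist (g (r n (φ n s))) (g s) ≤ 1 / (n + 1) := (le_max_right _ _).trans (hr n s).le
    linarith [(abs_le.mp h).2]

/-- A second countable space has a countable basis which is a π-system. -/
lemma exists_countable_isPiSystem_basis (X : Type*) [TopologicalSpace X]
    [SecondCountableTopology X] :
    ∃ B : Set (Set X), B.Countable ∧ IsPiSystem B ∧ TopologicalSpace.IsTopologicalBasis B := by
  obtain ⟨b, hbc, -, hb⟩ := TopologicalSpace.exists_countable_basis X
  refine ⟨(fun f ↦ ⋂₀ f) '' {f : Set (Set X) | f.Finite ∧ f ⊆ b},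
    (Set.countable_ofPred_finite_subset hbc).image _, ?_,
    TopologicalSpace.isTopologicalBasis_of_subbasis hb.eq_generateFrom⟩
  rintro _ ⟨F, hF, rfl⟩ _ ⟨G, hG, rfl⟩ -
  exact ⟨F ∪ G, ⟨hF.1.union hG.1, Set.union_subset hF.2 hG.2⟩, Set.sInter_union F G⟩

/-- The integral of a nonnegative lower semicontinuous function is lower semicontinuous with
respect to weak convergence of probability measures. -/
lemma LowerSemicontinuous.lintegral_le_liminf {Ω : Type*} [MeasurableSpace Ω] [TopologicalSpace Ω]
    [OpensMeasurableSpace Ω] [HasOuterApproxClosed Ω] {f : Ω → ℝ} (hf : LowerSemicontinuous f)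
    (hf0 : 0 ≤ f) {μ : ProbabilityMeasure Ω} {μs : ℕ → ProbabilityMeasure Ω}
    (h : Tendsto μs atTop (𝓝 μ)) :
    ∫⁻ x, ENNReal.ofReal (f x) ∂(μ : Measure Ω)
      ≤ liminf (fun n ↦ ∫⁻ x, ENNReal.ofReal (f x) ∂(μs n : Measure Ω)) atTop := by
  have hfm : Measurable f := hf.measurable
  simp_rw [lintegral_eq_lintegral_meas_lt _ (Eventually.of_forall hf0) hfm.aemeasurable]
  refine (lintegral_mono fun t ↦ ProbabilityMeasure.le_liminf_measure_open_of_tendsto h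
    (hf.isOpen_preimage t)).trans ?_
  exact lintegral_liminf_le fun n ↦ Antitone.measurable fun s t hst ↦
    measure_mono fun ω hω ↦ lt_of_le_of_lt hst hω

lemma MeasureTheory.Measure.map_bind {S Y Z : Type*} [MeasurableSpace S] [MeasurableSpace Y]
    [MeasurableSpace Z] (Γ : Measure S) {Q : S → Measure Y} (hQ : Measurable Q) {f : Y → Z}
    (hf : Measurable f) : (Γ.bind Q).map f = Γ.bind fun s ↦ (Q s).map f := by
  have hm : Measurable fun s ↦ (Q s).map f := (Measure.measurable_map f hf).comp hQ
  ext A hA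
  rw [Measure.map_apply hf hA, Measure.bind_apply (hf hA) hQ.aemeasurable,
    Measure.bind_apply hA hm.aemeasurable]
  simp_rw [Measure.map_apply hf hA]

lemma wassLike_le_lintegral {X : Type*} [MeasurableSpace X] {c : X → X → ℝ} {μ ν : Measure X}
    {Γ : Measure (X × X)} [hΓ : IsProbabilityMeasure Γ] (h : IsCoupling μ ν Γ) :
    wassLike c μ ν ≤ ∫⁻ p, ENNReal.ofReal (c p.1 p.2) ∂Γ :=
  iInf_le_of_le Γ <| iInf_le_of_le hΓ <| iInf_le _ h

lemma le_wassLike {X : Type*} [MeasurableSpace X] {c : X → X → ℝ} {μ ν : Measure X} {y : ℝ≥0∞}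
    (h : ∀ Γ : Measure (X × X), IsProbabilityMeasure Γ → IsCoupling μ ν Γ →
      y ≤ ∫⁻ p, ENNReal.ofReal (c p.1 p.2) ∂Γ) : y ≤ wassLike c μ ν :=
  le_iInf fun Γ ↦ le_iInf fun hΓ ↦ le_iInf fun hc ↦ h Γ hΓ hc

/-- A sequence of probability measures on a product whose marginals converge weakly is tight. -/
lemma isTightMeasureSet_of_tendsto_marginals {X : Type*} [MetricSpace X] [CompleteSpace X]
    [SecondCountableTopology X] [MeasurableSpace X] [BorelSpace X]
    {μ ν : ProbabilityMeasure X} {Γ : ℕ → ProbabilityMeasure (X × X)}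
    (h₁ : Tendsto (fun n ↦ (Γ n).map measurable_fst.aemeasurable) atTop (𝓝 μ))
    (h₂ : Tendsto (fun n ↦ (Γ n).map measurable_snd.aemeasurable) atTop (𝓝 ν)) :
    IsTightMeasureSet {(γ : Measure (X × X)) | γ ∈ Set.range Γ} := by
  have key : ∀ {η : ProbabilityMeasure X} {ηs : ℕ → ProbabilityMeasure X},
      Tendsto ηs atTop (𝓝 η) → IsTightMeasureSet {(γ : Measure X) | γ ∈ Set.range ηs} := by
    intro η ηs h
    refine isTightMeasureSet_of_isCompact_closure ?_
    exact h.isCompact_insert_range.closure_of_subset (Set.subset_insert _ _)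
  refine IsTightMeasureSet.prodMk ((key h₁).subset ?_) ((key h₂).subset ?_)
  · rintro _ ⟨_, ⟨_, ⟨n, rfl⟩, rfl⟩, rfl⟩
    exact ⟨_, ⟨n, rfl⟩, rfl⟩
  · rintro _ ⟨_, ⟨_, ⟨n, rfl⟩, rfl⟩, rfl⟩
    exact ⟨_, ⟨n, rfl⟩, rfl⟩

/-- Lower semicontinuity of the Wasserstein-like extension, in terms of couplings whose marginals
converge weakly. -/
lemma wassLike_le_of_tendsto {X : Type*} [MetricSpace X] [CompleteSpace X]
    [SecondCountableTopology X] [MeasurableSpace X] [BorelSpace X]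
    {c : X → X → ℝ} (hc : LowerSemicontinuous fun p : X × X ↦ c p.1 p.2) (hc0 : ∀ u v, 0 ≤ c u v)
    {μ ν : ProbabilityMeasure X} {Γ : ℕ → ProbabilityMeasure (X × X)}
    (h₁ : Tendsto (fun n ↦ (Γ n).map measurable_fst.aemeasurable) atTop (𝓝 μ))
    (h₂ : Tendsto (fun n ↦ (Γ n).map measurable_snd.aemeasurable) atTop (𝓝 ν))
    {b : ℕ → ℝ≥0∞} {L : ℝ≥0∞} (hb : Tendsto b atTop (𝓝 L))
    (hΓ : ∀ n, ∫⁻ p, ENNReal.ofReal (c p.1 p.2) ∂(Γ n : Measure (X × X)) ≤ b n) :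
    wassLike c μ ν ≤ L := by
  have hcomp := isCompact_closure_of_isTightMeasureSet
    (isTightMeasureSet_of_tendsto_marginals h₁ h₂)
  obtain ⟨γ, -, k, hk, hγ⟩ := hcomp.isSeqCompact fun n ↦ subset_closure (Set.mem_range_self n)
  have e₁ : γ.map measurable_fst.aemeasurable = μ := tendsto_nhds_unique
    (ProbabilityMeasure.tendsto_map_of_tendsto_of_continuous _ _ hγ continuous_fst)
    (h₁.comp hk.tendsto_atTop)
  have e₂ : γ.map measurable_snd.aemeasurable = ν := tendsto_nhds_unique
    (ProbabilityMeasure.tendsto_map_of_tendsto_of_continuous _ _ hγ continuous_snd)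
    (h₂.comp hk.tendsto_atTop)
  have hγc : IsCoupling (μ : Measure X) ν γ :=
    ⟨congrArg ProbabilityMeasure.toMeasure e₁, congrArg ProbabilityMeasure.toMeasure e₂⟩
  refine (wassLike_le_lintegral hγc).trans ?_
  calc ∫⁻ p, ENNReal.ofReal (c p.1 p.2) ∂(γ : Measure (X × X))
      ≤ liminf (fun n ↦ ∫⁻ p, ENNReal.ofReal (c p.1 p.2) ∂(Γ (k n) : Measure (X × X))) atTop :=
        hc.lintegral_le_liminf (fun p ↦ hc0 p.1 p.2) hγ
    _ ≤ liminf (fun n ↦ b (k n)) atTop := liminf_le_liminf (Eventually.of_forall fun n ↦ hΓ (k n))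
    _ = L := (hb.comp hk.tendsto_atTop).liminf_eq

/-- If kernels converge pointwise on a π-system forming a basis, then the averaged measures
converge weakly. -/
lemma tendsto_bind_of_tendsto_apply {S X : Type*} [MeasurableSpace S] [TopologicalSpace X]
    [SecondCountableTopology X] [MeasurableSpace X] [BorelSpace X]
    {B : Set (Set X)} (hB : IsPiSystem B) (hBb : TopologicalSpace.IsTopologicalBasis B)
    {Γ : Measure S} [IsProbabilityMeasure Γ] {Ks : ℕ → S → Measure X} {K : S → Measure X}
    (hKs : ∀ n, Measurable (Ks n)) (hK : Measurable K) [∀ n s, IsProbabilityMeasure (Ks n s)]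
    (h : ∀ A ∈ B, ∀ s, Tendsto (fun n ↦ Ks n s A) atTop (𝓝 (K s A)))
    {μs : ℕ → ProbabilityMeasure X} {μ : ProbabilityMeasure X}
    (hμs : ∀ n, (μs n : Measure X) = Γ.bind (Ks n)) (hμ : (μ : Measure X) = Γ.bind K) :
    Tendsto μs atTop (𝓝 μ) := by
  have hmeas : ∀ A ∈ B, MeasurableSet A := fun A hA ↦ (hBb.isOpen hA).measurableSet
  refine hB.tendsto_probabilityMeasure_of_tendsto_of_mem hmeas (fun u hu x hx ↦ ?_) fun A hA ↦ ?_
  · obtain ⟨A, hA, hxA, hAu⟩ := hBb.exists_subset_of_mem_open hx hu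
    exact ⟨A, hA, (hBb.isOpen hA).mem_nhds hxA, hAu⟩
  · rw [← ENNReal.tendsto_coe]
    simp only [ProbabilityMeasure.ennreal_coeFn_eq_coeFn_toMeasure, hμs, hμ]
    simp only [Measure.bind_apply (hmeas A hA) (hKs _).aemeasurable,
      Measure.bind_apply (hmeas A hA) hK.aemeasurable]
    refine tendsto_lintegral_of_dominated_convergence (fun _ ↦ 1)
      (fun n ↦ (Measure.measurable_coe (hmeas A hA)).comp (hKs n))
      (fun n ↦ Eventually.of_forall fun s ↦ prob_le_one) (by simp)
      (Eventually.of_forall fun s ↦ h A hA s)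

/-- **Convexity of the Wasserstein-like extension**: a measurable pointwise bound between two
kernels integrates to a bound between the averaged measures. -/
lemma wassLike_bind_le {S X : Type*} [MeasurableSpace S] [MetricSpace X] [CompleteSpace X]
    [SecondCountableTopology X] [MeasurableSpace X] [BorelSpace X]
    {c : X → X → ℝ} (hc : LowerSemicontinuous fun p : X × X ↦ c p.1 p.2) (hc0 : ∀ u v, 0 ≤ c u v)
    (Γ : Measure S) [IsProbabilityMeasure Γ] {K₁ K₂ : S → Measure X}
    (hK₁ : Measurable K₁) (hK₂ : Measurable K₂) [h₁ : ∀ s, IsProbabilityMeasure (K₁ s)]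
    [h₂ : ∀ s, IsProbabilityMeasure (K₂ s)] {g : S → ℝ} (hg : Measurable g) (hg0 : ∀ s, 0 ≤ g s)
    (h : ∀ s, wassLike c (K₁ s) (K₂ s) ≤ ENNReal.ofReal (g s)) :
    wassLike c (Γ.bind K₁) (Γ.bind K₂) ≤ ∫⁻ s, ENNReal.ofReal (g s) ∂Γ := by
  have : Nonempty S := nonempty_of_isProbabilityMeasure Γ
  obtain ⟨B, hBc, hB, hBb⟩ := exists_countable_isPiSystem_basis X
  have : Countable B := hBc
  have hmeas : ∀ A ∈ B, MeasurableSet A := fun A hA ↦ (hBb.isOpen hA).measurableSet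
  let F : S → (B → ℝ≥0∞) × (B → ℝ≥0∞) := fun s ↦ (fun A ↦ K₁ s A, fun A ↦ K₂ s A)
  have hF : Measurable F :=
    (measurable_pi_lambda _ fun A : B ↦ (Measure.measurable_coe (hmeas A A.2)).comp hK₁).prodMk
      (measurable_pi_lambda _ fun A : B ↦ (Measure.measurable_coe (hmeas A A.2)).comp hK₂)
  obtain ⟨φ, r, hφ, hr, hrg⟩ := exists_seq_measurable_sampling hF hg
  have hcoup : ∀ (n : ℕ) s, ∃ γ : ProbabilityMeasure (X × X), IsCoupling (K₁ s) (K₂ s) γ ∧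
      ∫⁻ p, ENNReal.ofReal (c p.1 p.2) ∂(γ : Measure (X × X))
        ≤ ENNReal.ofReal (g s) + ENNReal.ofReal (1 / (n + 1)) := by
    intro n s
    have hlt : wassLike c (K₁ s) (K₂ s) < ENNReal.ofReal (g s) + ENNReal.ofReal (1 / (n + 1)) :=
      (h s).trans_lt (ENNReal.lt_add_right ENNReal.ofReal_ne_top
        (ENNReal.ofReal_pos.2 (by positivity)).ne')
    simp only [wassLike, iInf_lt_iff] at hlt
    obtain ⟨γ, hγ, hγc, hγi⟩ := hlt
    exact ⟨⟨γ, hγ⟩, hγc, hγi.le⟩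
  choose π hπc hπi using hcoup
  let θ : ℕ → S → S := fun n s ↦ r n (φ n s)
  let Q : ℕ → S → Measure (X × X) := fun n s ↦ π n (θ n s)
  have hQ : ∀ n, Measurable (Q n) := fun n ↦
    (measurable_from_nat (f := fun k ↦ (π n (r n k) : Measure (X × X)))).comp (hφ n)
  have hp : ∀ n, IsProbabilityMeasure (Γ.bind (Q n)) := fun n ↦
    isProbabilityMeasure_bind (hQ n).aemeasurable (Eventually.of_forall fun s ↦ inferInstance)
  have hp₁ : IsProbabilityMeasure (Γ.bind K₁) :=
    isProbabilityMeasure_bind hK₁.aemeasurable (Eventually.of_forall h₁)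
  have hp₂ : IsProbabilityMeasure (Γ.bind K₂) :=
    isProbabilityMeasure_bind hK₂.aemeasurable (Eventually.of_forall h₂)
  have htwo : Tendsto (fun n : ℕ ↦ ∫⁻ s, ENNReal.ofReal (g s) ∂Γ
      + (ENNReal.ofReal (1 / (n + 1)) + ENNReal.ofReal (1 / (n + 1)))) atTop
      (𝓝 (∫⁻ s, ENNReal.ofReal (g s) ∂Γ)) := by
    have h0 : Tendsto (fun n : ℕ ↦ ENNReal.ofReal (1 / (n + 1))) atTop (𝓝 0) := by
      simpa using ENNReal.tendsto_ofReal (tendsto_one_div_add_atTop_nhds_zero_nat (𝕜 := ℝ))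
    simpa using tendsto_const_nhds.add (h0.add h0)
  refine wassLike_le_of_tendsto hc hc0 (μ := ⟨_, hp₁⟩) (ν := ⟨_, hp₂⟩)
    (Γ := fun n ↦ ⟨Γ.bind (Q n), hp n⟩) ?_ ?_ htwo fun n ↦ ?_
  · refine tendsto_bind_of_tendsto_apply hB hBb (Ks := fun n s ↦ K₁ (θ n s))
      (fun n ↦ (measurable_from_nat (f := fun k ↦ K₁ (r n k))).comp (hφ n)) hK₁
      (fun A hA s ↦ (((continuous_apply (⟨A, hA⟩ : B)).comp continuous_fst).tendsto _).comp (hr s))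
      (fun n ↦ ?_) rfl
    refine (Measure.map_bind Γ (hQ n) measurable_fst).trans ?_
    exact congrArg _ (funext fun s ↦ (hπc n _).1)
  · refine tendsto_bind_of_tendsto_apply hB hBb (Ks := fun n s ↦ K₂ (θ n s))
      (fun n ↦ (measurable_from_nat (f := fun k ↦ K₂ (r n k))).comp (hφ n)) hK₂
      (fun A hA s ↦ (((continuous_apply (⟨A, hA⟩ : B)).comp continuous_snd).tendsto _).comp (hr s))
      (fun n ↦ ?_) rfl
    refine (Measure.map_bind Γ (hQ n) measurable_snd).trans ?_
    exact congrArg _ (funext fun s ↦ (hπc n _).2)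
  · calc ∫⁻ p, ENNReal.ofReal (c p.1 p.2) ∂(Γ.bind (Q n))
        = ∫⁻ s, ∫⁻ p, ENNReal.ofReal (c p.1 p.2) ∂(Q n s) ∂Γ :=
          Measure.lintegral_bind (hQ n).aemeasurable hc.measurable.ennreal_ofReal.aemeasurable
      _ ≤ ∫⁻ s, (ENNReal.ofReal (g s)
            + (ENNReal.ofReal (1 / (n + 1)) + ENNReal.ofReal (1 / (n + 1)))) ∂Γ := by
          refine lintegral_mono fun s ↦ (hπi n (θ n s)).trans ?_
          rw [← add_assoc]
          gcongr
          rw [← ENNReal.ofReal_add (hg0 s) (by positivity)]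
          exact ENNReal.ofReal_le_ofReal (hrg n s)
      _ = _ := by
          rw [lintegral_add_right _ measurable_const, lintegral_const, measure_univ, mul_one]

lemma wassLike_mono {X : Type*} [MeasurableSpace X] {c c' : X → X → ℝ} (h : ∀ u v, c u v ≤ c' u v)
    (μ ν : Measure X) : wassLike c μ ν ≤ wassLike c' μ ν :=
  le_wassLike fun _ _ hΓc ↦ (wassLike_le_lintegral hΓc).trans <|
    lintegral_mono fun p ↦ ENNReal.ofReal_le_ofReal (h p.1 p.2)

lemma wassLike_le_one {X : Type*} [MeasurableSpace X] {c : X → X → ℝ} (h : ∀ u v, c u v ≤ 1)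
    (μ ν : Measure X) [IsProbabilityMeasure μ] [IsProbabilityMeasure ν] : wassLike c μ ν ≤ 1 := by
  have hc : IsCoupling μ ν (μ.prod ν) := ⟨by simp, by simp⟩
  refine (wassLike_le_lintegral hc).trans ?_
  calc ∫⁻ p, ENNReal.ofReal (c p.1 p.2) ∂(μ.prod ν)
      ≤ ∫⁻ _, 1 ∂(μ.prod ν) := lintegral_mono fun p ↦ by simpa using h p.1 p.2
    _ = 1 := by simp

lemma LowerSemicontinuous.mul_continuous_pos {Y : Type*} [TopologicalSpace Y] {f g : Y → ℝ}
    (hf : LowerSemicontinuous f) (hg : Continuous g) (hpos : ∀ y, 0 < g y) :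
    LowerSemicontinuous fun y ↦ f y * g y := by
  rw [lowerSemicontinuous_iff_isOpen_preimage]
  intro t
  have hsub : LowerSemicontinuous fun y ↦ f y + -(t / g y) :=
    hf.add (continuous_const.div hg fun y ↦ (hpos y).ne').neg.lowerSemicontinuous
  convert hsub.isOpen_preimage 0 using 1
  ext y
  simp only [Set.mem_preimage, Set.mem_Ioi, ← sub_eq_add_neg, sub_pos, div_lt_iff₀ (hpos y)]

lemma lowerSemicontinuous_expWeight {X : Type*} [NormedAddCommGroup X] {ρ : X → X → ℝ}
    (hρ : LowerSemicontinuous fun p : X × X ↦ ρ p.1 p.2) (a : ℝ) :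
    LowerSemicontinuous fun p : X × X ↦ expWeight ρ a p.1 p.2 :=
  (Real.continuous_sqrt.comp_lowerSemicontinuous hρ Real.sqrt_monotone).mul_continuous_pos
    (g := fun p : X × X ↦ Real.exp (a * ‖p.1‖ ^ 2 + a * ‖p.2‖ ^ 2)) (by fun_prop)
    fun _ ↦ Real.exp_pos _

lemma expWeight_nonneg {X : Type*} [NormedAddCommGroup X] (ρ : X → X → ℝ) (a : ℝ) (u v : X) :
    0 ≤ expWeight ρ a u v := by
  unfold expWeight
  positivity

lemma expWeight_mono {X : Type*} [NormedAddCommGroup X] (ρ : X → X → ℝ) {a b : ℝ} (h : a ≤ b)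
    (u v : X) : expWeight ρ a u v ≤ expWeight ρ b u v := by
  unfold expWeight
  gcongr

lemma lintegral_mul_le_sqrt_mul_sqrt {Y : Type*} [MeasurableSpace Y] {γ : Measure Y}
    {f g : Y → ℝ≥0∞} (hf : AEMeasurable f γ) (hg : AEMeasurable g γ) :
    ∫⁻ y, f y * g y ∂γ
      ≤ (∫⁻ y, f y ^ 2 ∂γ) ^ (1 / 2 : ℝ) * (∫⁻ y, g y ^ 2 ∂γ) ^ (1 / 2 : ℝ) := by
  simpa using! ENNReal.lintegral_mul_le_Lp_mul_Lq γ Real.HolderConjugate.two_two hf hg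

/-- Cauchy–Schwarz bound separating the distance-like function from its exponential weight. -/
lemma wassLike_expWeight_le {X : Type*} [NormedAddCommGroup X] [SecondCountableTopology X]
    [MeasurableSpace X] [BorelSpace X] {ρ : X → X → ℝ}
    (hρ : Measurable fun p : X × X ↦ ρ p.1 p.2) (hρ0 : ∀ u v, 0 ≤ ρ u v) {a A B : ℝ}
    {μ ν : Measure X}
    (hμ : ∫⁻ u, ENNReal.ofReal (Real.exp (4 * a * ‖u‖ ^ 2)) ∂μ ≤ ENNReal.ofReal (Real.exp A))
    (hν : ∫⁻ u, ENNReal.ofReal (Real.exp (4 * a * ‖u‖ ^ 2)) ∂ν ≤ ENNReal.ofReal (Real.exp B)) :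
    wassLike (expWeight ρ a) μ ν
      ≤ wassLike ρ μ ν ^ (1 / 2 : ℝ) * ENNReal.ofReal (Real.exp ((A + B) / 4)) := by
  set E := ENNReal.ofReal (Real.exp ((A + B) / 4)) with hE
  have hE0 : E ≠ 0 := (ENNReal.ofReal_pos.2 (Real.exp_pos _)).ne'
  have hEt : E ≠ ⊤ := ENNReal.ofReal_ne_top
  let w : X → ℝ≥0∞ := fun u ↦ ENNReal.ofReal (Real.exp (a * ‖u‖ ^ 2))
  have hw : Measurable w := by fun_prop
  have hw4 : ∀ u, (w u ^ 2) ^ 2 = ENNReal.ofReal (Real.exp (4 * a * ‖u‖ ^ 2)) := fun u ↦ by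
    rw [← pow_mul, ← ENNReal.ofReal_pow (Real.exp_pos _).le, ← Real.exp_nat_mul]
    push_cast
    ring_nf
  have hcoup : ∀ Γ : Measure (X × X), IsCoupling μ ν Γ →
      ∫⁻ p, ENNReal.ofReal (expWeight ρ a p.1 p.2) ∂Γ
        ≤ (∫⁻ p, ENNReal.ofReal (ρ p.1 p.2) ∂Γ) ^ (1 / 2 : ℝ) * E := by
    rintro Γ ⟨h₁, h₂⟩
    have e₁ : ∫⁻ p, (w p.1 ^ 2) ^ 2 ∂Γ ≤ ENNReal.ofReal (Real.exp A) := by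
      rw [← h₁, lintegral_map (by fun_prop) measurable_fst] at hμ
      simpa only [hw4] using hμ
    have e₂ : ∫⁻ p, (w p.2 ^ 2) ^ 2 ∂Γ ≤ ENNReal.ofReal (Real.exp B) := by
      rw [← h₂, lintegral_map (by fun_prop) measurable_snd] at hν
      simpa only [hw4] using hν
    calc ∫⁻ p, ENNReal.ofReal (expWeight ρ a p.1 p.2) ∂Γ
        = ∫⁻ p, ENNReal.ofReal (√(ρ p.1 p.2)) * (w p.1 * w p.2) ∂Γ := by
          refine lintegral_congr fun p ↦ ?_
          rw [expWeight, ENNReal.ofReal_mul (Real.sqrt_nonneg _), Real.exp_add,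
            ENNReal.ofReal_mul (Real.exp_pos _).le]
      _ ≤ (∫⁻ p, ENNReal.ofReal (√(ρ p.1 p.2)) ^ 2 ∂Γ) ^ (1 / 2 : ℝ)
            * (∫⁻ p, (w p.1 * w p.2) ^ 2 ∂Γ) ^ (1 / 2 : ℝ) :=
          lintegral_mul_le_sqrt_mul_sqrt (by fun_prop) (by fun_prop)
      _ ≤ (∫⁻ p, ENNReal.ofReal (ρ p.1 p.2) ∂Γ) ^ (1 / 2 : ℝ) * E := by
          gcongr ?_ ^ (1 / 2 : ℝ) * ?_
          · refine lintegral_mono fun p ↦ ?_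
            rw [← ENNReal.ofReal_pow (Real.sqrt_nonneg _), Real.sq_sqrt (hρ0 _ _)]
          · calc (∫⁻ p, (w p.1 * w p.2) ^ 2 ∂Γ) ^ (1 / 2 : ℝ)
                ≤ ((∫⁻ p, (w p.1 ^ 2) ^ 2 ∂Γ) ^ (1 / 2 : ℝ)
                    * (∫⁻ p, (w p.2 ^ 2) ^ 2 ∂Γ) ^ (1 / 2 : ℝ)) ^ (1 / 2 : ℝ) := by
                  simp_rw [mul_pow]
                  gcongr
                  exact lintegral_mul_le_sqrt_mul_sqrt (by fun_prop) (by fun_prop)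
              _ ≤ (ENNReal.ofReal (Real.exp A) ^ (1 / 2 : ℝ)
                    * ENNReal.ofReal (Real.exp B) ^ (1 / 2 : ℝ)) ^ (1 / 2 : ℝ) := by
                  gcongr
              _ = E := by
                  rw [← ENNReal.mul_rpow_of_nonneg _ _ (by norm_num),
                    ← ENNReal.ofReal_mul (Real.exp_pos _).le, ← Real.exp_add, ← ENNReal.rpow_mul,
                    ENNReal.ofReal_rpow_of_pos (Real.exp_pos _), ← Real.exp_mul, hE]
                  ring_nf
  have hsq : (wassLike (expWeight ρ a) μ ν / E) ^ (2 : ℝ) ≤ wassLike ρ μ ν := by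
    refine le_wassLike fun Γ hΓ hc ↦ ?_
    rw [← ENNReal.le_rpow_inv_iff (by norm_num), ENNReal.div_le_iff hE0 hEt, ← one_div]
    exact (wassLike_le_lintegral hc).trans (hcoup Γ hc)
  rwa [← ENNReal.le_rpow_inv_iff (by norm_num), ENNReal.div_le_iff hE0 hEt, ← one_div] at hsq

/-- A pointwise bound between the transition probabilities of a Markov kernel extends to
arbitrary initial distributions. -/
lemma wassLike_bind_le_mul {X : Type*} [MetricSpace X] [CompleteSpace X]
    [SecondCountableTopology X] [MeasurableSpace X] [BorelSpace X]
    {c c' : X → X → ℝ} (hc : LowerSemicontinuous fun p : X × X ↦ c p.1 p.2)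
    (hc0 : ∀ u v, 0 ≤ c u v) (hc' : Measurable fun p : X × X ↦ c' p.1 p.2)
    (hc'0 : ∀ u v, 0 ≤ c' u v) {K : X → Measure X} (hK : IsMarkovKernelFun K) {l : ℝ} (hl : 0 < l)
    (h : ∀ u v, wassLike c (K u) (K v) ≤ ENNReal.ofReal (l * c' u v)) (μ ν : Measure X) :
    wassLike c (μ.bind K) (ν.bind K) ≤ ENNReal.ofReal l * wassLike c' μ ν := by
  rw [← ENNReal.div_le_iff' (ENNReal.ofReal_pos.2 hl).ne' ENNReal.ofReal_ne_top]
  refine le_wassLike fun Γ hΓ ⟨h₁, h₂⟩ ↦ ?_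
  rw [ENNReal.div_le_iff' (ENNReal.ofReal_pos.2 hl).ne' ENNReal.ofReal_ne_top]
  have hbind : ∀ f : X × X → X, Measurable f → (Γ.map f).bind K = Γ.bind fun p ↦ K (f p) :=
    fun f hf ↦ by rw [Measure.bind, Measure.map_map hK.1 hf]; rfl
  rw [← h₁, ← h₂, hbind _ measurable_fst, hbind _ measurable_snd,
    ← lintegral_const_mul _ hc'.ennreal_ofReal]
  simp_rw [← ENNReal.ofReal_mul hl.le]
  exact wassLike_bind_le hc hc0 Γ (hK.1.comp measurable_fst) (hK.1.comp measurable_snd)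
    (h₁ := fun p ↦ hK.2 p.1) (h₂ := fun p ↦ hK.2 p.2) (hc'.const_mul l) (fun p ↦ mul_nonneg hl.le (hc'0 _ _)) fun p ↦ h p.1 p.2

/-- The time index set of a continuous- or discrete-time semigroup. -/
def IsTimeSet (I : Set ℝ) : Prop :=
  I = Set.Ici (0 : ℝ) ∨ ∃ δ > (0 : ℝ), I = {t : ℝ | ∃ n : ℕ, t = n * δ}

namespace IsTimeSet

variable {I : Set ℝ}

lemma add_mem (hI : IsTimeSet I) {s t : ℝ} (hs : s ∈ I) (ht : t ∈ I) : s + t ∈ I := by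
  rcases hI with rfl | ⟨δ, -, rfl⟩
  · exact add_nonneg (Set.mem_Ici.1 hs) (Set.mem_Ici.1 ht)
  · obtain ⟨m, rfl⟩ := hs
    obtain ⟨n, rfl⟩ := ht
    exact ⟨m + n, by push_cast; ring⟩

lemma sub_mul_mem (hI : IsTimeSet I) {s t : ℝ} (hs : s ∈ I) (ht : t ∈ I) (k : ℕ)
    (h : 0 ≤ t - k * s) : t - k * s ∈ I := by
  rcases hI with rfl | ⟨δ, hδ, rfl⟩
  · exact h
  · obtain ⟨m, rfl⟩ := hs
    obtain ⟨n, rfl⟩ := ht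
    have hle : k * m ≤ n := by
      have : ((k * m : ℕ) : ℝ) * δ ≤ n * δ := by push_cast; linarith
      exact_mod_cast le_of_mul_le_mul_right this hδ
    exact ⟨n - k * m, by push_cast [Nat.cast_sub hle]; ring⟩

lemma exists_ge (hI : IsTimeSet I) (T : ℝ) : ∃ t ∈ I, T ≤ t := by
  rcases hI with rfl | ⟨δ, hδ, rfl⟩
  · exact ⟨max T 0, Set.mem_Ici.2 (le_max_right _ _), le_max_left _ _⟩
  · refine ⟨⌈T / δ⌉₊ * δ, ⟨_, rfl⟩, ?_⟩
    rw [← div_le_iff₀ hδ]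
    exact Nat.le_ceil _

lemma exists_eq_add_mul (hI : IsTimeSet I) {τ t : ℝ} (hτ : τ ∈ I) (hτ0 : 0 < τ) (ht : t ∈ I)
    (h : τ ≤ t) : ∃ (k : ℕ), ∃ s ∈ I, τ ≤ s ∧ t = s + k * τ ∧ t ≤ (k + 2) * τ := by
  have h1 : 1 ≤ ⌊t / τ⌋₊ := by
    rw [Nat.one_le_floor_iff, one_le_div hτ0]
    exact h
  obtain ⟨k, hk⟩ := Nat.exists_eq_add_of_le' h1
  have hlo : (k + 1) * τ ≤ t := by
    have := Nat.floor_le (div_nonneg (hτ0.le.trans h) hτ0.le)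
    rw [hk, le_div_iff₀ hτ0] at this
    exact_mod_cast this
  have hhi : t ≤ (k + 2) * τ := by
    have := (Nat.lt_floor_add_one (t / τ)).le
    rw [hk, div_le_iff₀ hτ0] at this
    push_cast at this
    linarith
  exact ⟨k, t - k * τ, hI.sub_mul_mem hτ ht k (by linarith), by linarith, by ring, hhi⟩

/-- A one-step contraction valid at all large times yields exponential decay. -/
lemma wassLike_exp_decay {X : Type*} [MeasurableSpace X] (hI : IsTimeSet I) {P : ℝ → X → Measure X}
    (hker : ∀ t ∈ I, IsMarkovKernelFun (P t))
    (hCK : ∀ t ∈ I, ∀ s ∈ I, t + s ∈ I → ∀ u : X, P (t + s) u = (P t u).bind (P s))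
    {c c' : X → X → ℝ} (hcc' : ∀ u v, c' u v ≤ c u v) {η T : ℝ} (hη : 0 < η)
    (h : ∀ t ∈ I, T ≤ t → ∀ μ ν : Measure X,
      wassLike c (μ.bind (P t)) (ν.bind (P t))
        ≤ ENNReal.ofReal (Real.exp (-η)) * wassLike c' μ ν) :
    ∃ T > (0 : ℝ), ∃ C₁ > (0 : ℝ), ∃ C₂ > (0 : ℝ), ∀ t ∈ I, T ≤ t → ∀ μ ν : Measure X,
      wassLike c (μ.bind (P t)) (ν.bind (P t))
        ≤ ENNReal.ofReal (C₁ * Real.exp (-C₂ * t)) * wassLike c' μ ν := by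
  obtain ⟨τ, hτI, hτ⟩ := hI.exists_ge (max T 1)
  have hτ0 : 0 < τ := one_pos.trans_le ((le_max_right _ _).trans hτ)
  have hτT : T ≤ τ := (le_max_left _ _).trans hτ
  have hbind : ∀ s ∈ I, ∀ t ∈ I, ∀ μ : Measure X,
      μ.bind (P (s + t)) = (μ.bind (P s)).bind (P t) := by
    intro s hs t ht μ
    rw [Measure.bind_bind (hker s hs).1.aemeasurable (hker t ht).1.aemeasurable]
    exact congrArg _ (funext fun u ↦ hCK s hs t ht (hI.add_mem hs ht) u)
  have hiter : ∀ s ∈ I, τ ≤ s → ∀ k : ℕ, s + k * τ ∈ I ∧ ∀ μ ν : Measure X,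
      wassLike c (μ.bind (P (s + k * τ))) (ν.bind (P (s + k * τ)))
        ≤ ENNReal.ofReal (Real.exp (-η * (k + 1))) * wassLike c' μ ν := by
    intro s hs hτs k
    induction k with
    | zero => exact ⟨by simpa using hs, fun μ ν ↦ by simpa using h s hs (hτT.trans hτs) μ ν⟩
    | succ k ih =>
      have e : s + ((k + 1 : ℕ) : ℝ) * τ = s + k * τ + τ := by push_cast; ring
      rw [e]
      refine ⟨hI.add_mem ih.1 hτI, fun μ ν ↦ ?_⟩
      rw [hbind _ ih.1 _ hτI, hbind _ ih.1 _ hτI]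
      calc _ ≤ ENNReal.ofReal (Real.exp (-η))
              * (ENNReal.ofReal (Real.exp (-η * (k + 1))) * wassLike c' μ ν) := by
            grw [h τ hτI hτT, wassLike_mono hcc', ih.2 μ ν]
        _ = _ := by
            rw [← mul_assoc, ← ENNReal.ofReal_mul (Real.exp_pos _).le, ← Real.exp_add]
            push_cast
            ring_nf
  refine ⟨τ, hτ0, Real.exp η, Real.exp_pos _, η / τ, div_pos hη hτ0, fun t ht hτt μ ν ↦ ?_⟩
  obtain ⟨k, s, hs, hτs, rfl, hk⟩ := hI.exists_eq_add_mul hτI hτ0 ht hτt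
  refine ((hiter s hs hτs k).2 μ ν).trans ?_
  gcongr
  rw [← Real.exp_add]
  gcongr
  have h1 : (s + k * τ) / τ ≤ k + 2 := (div_le_iff₀ hτ0).2 hk
  have h2 : η / τ * (s + k * τ) = η * ((s + k * τ) / τ) := by ring
  nlinarith

end IsTimeSet

/-- Combining a bound on the distance-like function with the exponential Lyapunov structure. -/
lemma wassLike_expWeight_le_of_le {X : Type*} [NormedAddCommGroup X] [SecondCountableTopology X]
    [MeasurableSpace X] [BorelSpace X] {ρ : X → X → ℝ}
    (hρ : Measurable fun p : X × X ↦ ρ p.1 p.2) (hρ0 : ∀ u v, 0 ≤ ρ u v)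
    {a b A B x η : ℝ} {μ ν : Measure X} {u v : X}
    (hμ : ∫⁻ u, ENNReal.ofReal (Real.exp (4 * a * ‖u‖ ^ 2)) ∂μ ≤ ENNReal.ofReal (Real.exp A))
    (hν : ∫⁻ u, ENNReal.ofReal (Real.exp (4 * a * ‖u‖ ^ 2)) ∂ν ≤ ENNReal.ofReal (Real.exp B))
    (hx : wassLike ρ μ ν ≤ ENNReal.ofReal (Real.exp (2 * x) * ρ u v))
    (h : x + (A + B) / 4 ≤ -η + (b * ‖u‖ ^ 2 + b * ‖v‖ ^ 2)) :
    wassLike (expWeight ρ a) μ ν ≤ ENNReal.ofReal (Real.exp (-η) * expWeight ρ b u v) := by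
  refine (wassLike_expWeight_le hρ hρ0 hμ hν).trans ?_
  calc wassLike ρ μ ν ^ (1 / 2 : ℝ) * ENNReal.ofReal (Real.exp ((A + B) / 4))
      ≤ ENNReal.ofReal (Real.exp (2 * x) * ρ u v) ^ (1 / 2 : ℝ)
          * ENNReal.ofReal (Real.exp ((A + B) / 4)) := by gcongr
    _ = ENNReal.ofReal (√(ρ u v) * Real.exp (x + (A + B) / 4)) := by
        have hpos : 0 ≤ Real.exp (2 * x) * ρ u v := mul_nonneg (Real.exp_pos _).le (hρ0 _ _)
        rw [ENNReal.ofReal_rpow_of_nonneg hpos (by norm_num), ← Real.sqrt_eq_rpow,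
          ← ENNReal.ofReal_mul (Real.sqrt_nonneg _), Real.sqrt_mul (Real.exp_pos _).le,
          Real.sqrt_eq_rpow (Real.exp _), ← Real.exp_mul, Real.exp_add]
        ring_nf
    _ ≤ ENNReal.ofReal (Real.exp (-η) * expWeight ρ b u v) := by
        rw [expWeight, mul_left_comm, ← Real.exp_add]
        gcongr

/-- Weak Harris theorem, exponential contraction form (Theorem 2.2, inequality (2.11)):
with the additional finite-time bound (A3.ii), one obtains exponential decay
`W_{ρ_α}(μP_t, νP_t) ≤ C₁ e^{-C₂ t} W_{ρ_{α/m}}(μ, ν)`. -/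
theorem weak_harris_exponential_contraction
    {X : Type*} [NormedAddCommGroup X] [NormedSpace ℝ X] [CompleteSpace X]
    [SecondCountableTopology X] [MeasurableSpace X] [BorelSpace X]
    (I : Set ℝ)
    (hIform : I = Set.Ici (0 : ℝ) ∨ ∃ δ > (0 : ℝ), I = {t : ℝ | ∃ n : ℕ, t = n * δ})
    (P : ℝ → X → Measure X)
    (hker : ∀ t ∈ I, IsMarkovKernelFun (P t))
    (hP0 : (0 : ℝ) ∈ I → ∀ u : X, P 0 u = Measure.dirac u)
    (hCK : ∀ t ∈ I, ∀ s ∈ I, t + s ∈ I →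
      ∀ u : X, P (t + s) u = (P t u).bind (P s))
    (Λ : Set (X → X → ℝ))
    (hΛ : ∀ ρ ∈ Λ, DistanceLike ρ ∧ ∀ u v : X, ρ u v ≤ 1)
    -- (A1) exponential Lyapunov structure
    (ψ : ℝ → ℝ) (hψc : Continuous ψ) (hψ0 : ∀ t, 0 ≤ ψ t)
    (hψlim : Tendsto ψ atTop (nhds 0))
    (α₀ C₀ : ℝ) (hα₀ : 0 < α₀) (hC₀ : 0 < C₀)
    (hA1 : ∀ α ∈ Set.Ioc (0 : ℝ) α₀, ∀ t ∈ I, ∀ u₀ : X,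
      ∫⁻ u, ENNReal.ofReal (Real.exp (α * ‖u‖ ^ 2)) ∂(P t u₀)
        ≤ ENNReal.ofReal (Real.exp (α * (ψ t * ‖u₀‖ ^ 2 + C₀))))
    -- (A2) eventual ρ-smallness of bounded sets
    (hA2 : ∀ M > (0 : ℝ), ∃ κ₁ ∈ Set.Ioo (0 : ℝ) 1, ∀ ρ ∈ Λ, ∃ T₁ > (0 : ℝ),
      ∀ t ∈ I, T₁ ≤ t → ∀ u₀ v₀ : X, ‖u₀‖ ≤ M → ‖v₀‖ ≤ M →
        wassLike ρ (P t u₀) (P t v₀) ≤ ENNReal.ofReal (1 - κ₁))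
    -- (A3): for every κ₂ and r there is ρ ∈ Λ satisfying both (A3.i) and (A3.ii)
    (hA3 : ∀ κ₂ ∈ Set.Ioo (0 : ℝ) 1, ∀ r > (0 : ℝ), ∃ ρ ∈ Λ,
      -- (A3.i) eventual local ρ-contractivity
      (∃ T₂ > (0 : ℝ), ∀ t ∈ I, T₂ ≤ t → ∀ u₀ v₀ : X, ρ u₀ v₀ < 1 →
        wassLike ρ (P t u₀) (P t v₀)
          ≤ ENNReal.ofReal (κ₂ * Real.exp (r * ‖u₀‖ ^ 2) * ρ u₀ v₀)) ∧
      -- (A3.ii) finite-time bound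
      (∀ τ ≥ (0 : ℝ), ∃ C > (0 : ℝ), ∀ t ∈ I, t ≤ τ → ∀ u₀ v₀ : X, ρ u₀ v₀ < 1 →
        wassLike ρ (P t u₀) (P t v₀)
          ≤ ENNReal.ofReal (C * Real.exp (r * ‖u₀‖ ^ 2) * ρ u₀ v₀))) :
    ∀ m : ℝ, 1 ≤ m → ∃ αm > (0 : ℝ), ∀ α ∈ Set.Ioc (0 : ℝ) αm, ∃ ρ ∈ Λ,
      ∃ T > (0 : ℝ), ∃ C₁ > (0 : ℝ), ∃ C₂ > (0 : ℝ), ∀ t ∈ I, T ≤ t →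
        ∀ μ ν : Measure X, IsProbabilityMeasure μ → IsProbabilityMeasure ν →
          wassLike (expWeight ρ α) (μ.bind (P t)) (ν.bind (P t))
            ≤ ENNReal.ofReal (C₁ * Real.exp (-C₂ * t))
              * wassLike (expWeight ρ (α / m)) μ ν := by
  intro m hm
  have hm0 : 0 < m := one_pos.trans_le hm
  obtain ⟨κ₁, ⟨hκ0, hκ1⟩, hA2⟩ := hA2 (√(6 * m * C₀)) (by positivity)
  obtain ⟨q, hq⟩ : ∃ q : ℝ, Real.exp (-q) = 1 - κ₁ :=
    ⟨-Real.log (1 - κ₁), by rw [neg_neg, Real.exp_log (by linarith)]⟩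
  have hq0 : 0 < q := by
    have : Real.exp (-q) < 1 := by linarith
    linarith [Real.exp_lt_one_iff.1 this]
  refine ⟨min (α₀ / 4) (q / (8 * C₀)), by positivity, fun α ⟨hα, hαm⟩ ↦ ?_⟩
  have hα4 : 4 * α ≤ α₀ := by linarith [hαm.trans (min_le_left _ _)]
  have hαq : 8 * (α * C₀) ≤ q := by
    have := (le_div_iff₀ (by positivity)).1 (hαm.trans (min_le_right _ _))
    linarith
  obtain ⟨ρ, hρΛ, ⟨T₂, -, hT₂⟩, -⟩ :=
    hA3 (Real.exp (-q)) ⟨Real.exp_pos _, by linarith⟩ (α / m) (by positivity)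
  obtain ⟨T₁, -, hT₁⟩ := hA2 ρ hρΛ
  obtain ⟨⟨hρ0, -, hρlsc, -⟩, hρ1⟩ := hΛ ρ hρΛ
  obtain ⟨T₃, hT₃⟩ : ∃ T₃, ∀ t ≥ T₃, ψ t ≤ 1 / (2 * m) :=
    eventually_atTop.1 (hψlim.eventually_le_const (by positivity))
  set η := min (q / 4) (α * C₀) with hη
  have hη0 : 0 < η := by positivity
  have hηq : η ≤ q / 4 := min_le_left _ _
  have hηα : η ≤ α * C₀ := min_le_right _ _
  have hpt : ∀ t ∈ I, max T₁ (max T₂ T₃) ≤ t → ∀ u v : X,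
      wassLike (expWeight ρ α) (P t u) (P t v)
        ≤ ENNReal.ofReal (Real.exp (-η) * expWeight ρ (α / m) u v) := by
    intro t ht hTt u v
    have ht₁ : T₁ ≤ t := (le_max_left _ _).trans hTt
    have ht₂ : T₂ ≤ t := (le_max_left _ _).trans ((le_max_right _ _).trans hTt)
    have ht₃ : T₃ ≤ t := (le_max_right _ _).trans ((le_max_right _ _).trans hTt)
    have := (hker t ht).2
    have hlyap := hA1 (4 * α) ⟨by positivity, hα4⟩ t ht
    have hgrowth : (4 * α * (ψ t * ‖u‖ ^ 2 + C₀) + 4 * α * (ψ t * ‖v‖ ^ 2 + C₀)) / 4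
        ≤ α / m * (‖u‖ ^ 2 + ‖v‖ ^ 2) / 2 + 2 * (α * C₀) := by
      have h1 : α * (‖u‖ ^ 2 + ‖v‖ ^ 2) * ψ t ≤ α * (‖u‖ ^ 2 + ‖v‖ ^ 2) * (1 / (2 * m)) := by
        gcongr
        exact hT₃ t ht₃
      have h2 : α * (‖u‖ ^ 2 + ‖v‖ ^ 2) * (1 / (2 * m)) = α / m * (‖u‖ ^ 2 + ‖v‖ ^ 2) / 2 := by
        field_simp
      linarith
    have hu0 : 0 ≤ α / m * ‖u‖ ^ 2 := by positivity
    have hv0 : 0 ≤ α / m * ‖v‖ ^ 2 := by positivity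
    rcases lt_or_ge (ρ u v) 1 with hlt | hge
    · refine wassLike_expWeight_le_of_le hρlsc.measurable hρ0 (hlyap u) (hlyap v)
        (x := -q / 2 + α / m * ‖u‖ ^ 2 / 2) ((hT₂ t ht ht₂ u v hlt).trans_eq ?_) (by linarith)
      rw [← Real.exp_add]
      ring_nf
    have hone : ρ u v = 1 := le_antisymm (hρ1 u v) hge
    rcases lt_or_ge (6 * m * C₀) (‖u‖ ^ 2 + ‖v‖ ^ 2) with hbig | hsmall
    · refine wassLike_expWeight_le_of_le hρlsc.measurable hρ0 (hlyap u) (hlyap v) (x := 0)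
        ((wassLike_le_one hρ1 _ _).trans_eq (by simp [hone])) ?_
      have h1 : α / m * (6 * m * C₀) ≤ α / m * (‖u‖ ^ 2 + ‖v‖ ^ 2) := by gcongr
      have h2 : α / m * (6 * m * C₀) = 6 * (α * C₀) := by field_simp
      linarith
    · refine wassLike_expWeight_le_of_le hρlsc.measurable hρ0 (hlyap u) (hlyap v) (x := -q / 2)
        ((hT₁ t ht ht₁ u v (Real.le_sqrt_of_sq_le (by nlinarith [sq_nonneg ‖v‖]))
          (Real.le_sqrt_of_sq_le (by nlinarith [sq_nonneg ‖u‖]))).trans_eq ?_) (by linarith)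
      rw [hone, ← hq]
      ring_nf
  have hmono : α / m ≤ α := div_le_self hα.le hm
  obtain ⟨T, hT, C₁, hC₁, C₂, hC₂, hdecay⟩ :=
    IsTimeSet.wassLike_exp_decay hIform hker hCK (fun u v ↦ expWeight_mono ρ hmono u v) hη0
      fun t ht hTt μ ν ↦ wassLike_bind_le_mul (lowerSemicontinuous_expWeight hρlsc α)
        (expWeight_nonneg ρ α) (lowerSemicontinuous_expWeight hρlsc (α / m)).measurable
        (expWeight_nonneg ρ (α / m)) (hker t ht) (Real.exp_pos _) (hpt t ht hTt) μ ν
  exact ⟨ρ, hρΛ, T, hT, C₁, hC₁, C₂, hC₂, fun t ht hTt μ ν _ _ ↦ hdecay t ht hTt μ ν⟩
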